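/- The maximal length of an antichain sequence s_1, …, s_L in ℤ_{≥0}^3 with deg(s_i) ≤ 2·Fib_i for all 1 ≤ i ≤ L is equal to 10. -/

import Mathlib

/-- An antichain coloured with `n` colours so that equally coloured elements are comparable
has at most `n` elements. -/
lemma IsAntichain.card_le_of_chain_coloring {α : Type*} [PartialOrder α] {T : Finset α}
    (hT : IsAntichain (· ≤ ·) (T : Set α)) {n : ℕ} (c : α → ℕ) (hc : ∀ p ∈ T, c p < n)
    (hcomp : ∀ p ∈ T, ∀ q ∈ T, c p = c q → p ≤ q ∨ q ≤ p) : T.card ≤ n := by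
  have h := Finset.card_le_card_of_injOn (t := Finset.range n) c (by simpa [Set.MapsTo] using hc)
    (fun p hp q hq hpq => (hcomp p hp q hq hpq).elim (hT.eq hp hq) (hT.eq' hp hq))
  simpa using h

set_option maxHeartbeats 2000000 in
/-- Two incomparable points of degree at most two confine the points above neither of them to a
coordinate plane together with a chain, or to the union of four chains. -/
lemma exists_cover_of_not_ge {u v : Fin 3 → ℕ} (hu : ∑ m, u m ≤ 2) (hv : ∑ m, v m ≤ 2)
    (huv : ¬ u ≤ v) (hvu : ¬ v ≤ u) :
    ∃ σ : Equiv.Perm (Fin 3),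
      (∀ p : Fin 3 → ℕ, ¬ u ≤ p → ¬ v ≤ p → p (σ 0) = 0 ∨ p (σ 0) = 1 ∧ p (σ 1) = 0) ∨
      (∀ p : Fin 3 → ℕ, ¬ u ≤ p → ¬ v ≤ p → p (σ 0) = 0 ∨ p (σ 1) = 0 ∧ p (σ 2) = 0) ∨
      (∀ p : Fin 3 → ℕ, ¬ u ≤ p → ¬ v ≤ p → p (σ 0) ≤ 1 ∧ p (σ 1) ≤ 1) ∨
      (∀ p : Fin 3 → ℕ, ¬ u ≤ p → ¬ v ≤ p → p (σ 0) ≤ 1 ∧ (p (σ 1) = 0 ∨ p (σ 2) = 0)) := by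
  have perm : ∀ i j k : Fin 3, i ≠ j → i ≠ k → j ≠ k →
      ∃ σ : Equiv.Perm (Fin 3), σ 0 = i ∧ σ 1 = j ∧ σ 2 = k := by decide
  suffices h : ∃ i j k : Fin 3, (i ≠ j ∧ i ≠ k ∧ j ≠ k) ∧
      ((∀ p : Fin 3 → ℕ, ¬ u ≤ p → ¬ v ≤ p → p i = 0 ∨ p i = 1 ∧ p j = 0) ∨
      (∀ p : Fin 3 → ℕ, ¬ u ≤ p → ¬ v ≤ p → p i = 0 ∨ p j = 0 ∧ p k = 0) ∨
      (∀ p : Fin 3 → ℕ, ¬ u ≤ p → ¬ v ≤ p → p i ≤ 1 ∧ p j ≤ 1) ∨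
      (∀ p : Fin 3 → ℕ, ¬ u ≤ p → ¬ v ≤ p → p i ≤ 1 ∧ (p j = 0 ∨ p k = 0))) by
    obtain ⟨i, j, k, ⟨hij, hik, hjk⟩, h⟩ := h
    obtain ⟨σ, rfl, rfl, rfl⟩ := perm i j k hij hik hjk
    exact ⟨σ, h⟩
  simp only [Pi.le_def, Fin.forall_fin_succ, Fin.sum_univ_three, IsEmpty.forall_iff, and_true,
    Fin.succ_zero_eq_one, Fin.succ_one_eq_two] at *
  generalize u 0 = a, u 1 = b, u 2 = c, v 0 = d, v 1 = e, v 2 = f at *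
  have ha : a ≤ 2 := by omega
  have hb : b ≤ 2 := by omega
  have hc : c ≤ 2 := by omega
  have hd : d ≤ 2 := by omega
  have he : e ≤ 2 := by omega
  have hf : f ≤ 2 := by omega
  interval_cases a <;> interval_cases b <;> try omega
  all_goals interval_cases c <;> try omega
  all_goals interval_cases d <;> try omega
  all_goals interval_cases e <;> try omega
  all_goals interval_cases f <;> try omega
  all_goals
    first
    | refine ⟨0, 1, 2, by decide, ?_⟩
      first
      | exact Or.inl fun p h h' => by omega
      | exact Or.inr (Or.inl fun p h h' => by omega)
      | exact Or.inr (Or.inr (Or.inl fun p h h' => by omega))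
      | exact Or.inr (Or.inr (Or.inr fun p h h' => by omega))
    | refine ⟨0, 2, 1, by decide, ?_⟩
      first
      | exact Or.inl fun p h h' => by omega
      | exact Or.inr (Or.inr (Or.inl fun p h h' => by omega))
    | refine ⟨1, 0, 2, by decide, ?_⟩
      first
      | exact Or.inl fun p h h' => by omega
      | exact Or.inr (Or.inl fun p h h' => by omega)
      | exact Or.inr (Or.inr (Or.inr fun p h h' => by omega))
    | refine ⟨1, 2, 0, by decide, ?_⟩
      first
      | exact Or.inl fun p h h' => by omega
      | exact Or.inr (Or.inr (Or.inl fun p h h' => by omega))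
    | refine ⟨2, 0, 1, by decide, ?_⟩
      first
      | exact Or.inl fun p h h' => by omega
      | exact Or.inr (Or.inl fun p h h' => by omega)
      | exact Or.inr (Or.inr (Or.inr fun p h h' => by omega))
    | exact ⟨2, 1, 0, by decide, Or.inl fun p h h' => by omega⟩

lemma Pi.le_iff_apply_perm_fin_three (σ : Equiv.Perm (Fin 3)) (p r : Fin 3 → ℕ) :
    p ≤ r ↔ p (σ 0) ≤ r (σ 0) ∧ p (σ 1) ≤ r (σ 1) ∧ p (σ 2) ≤ r (σ 2) := by
  rw [Pi.le_def, ← σ.forall_congr_right]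
  simp [Fin.forall_fin_succ]

/-- An antichain covered by a coordinate plane and a chain, containing two points of degree at most
`d`, has at most `d + 2` elements. -/
lemma card_le_of_plane_or_chain {T : Finset (Fin 3 → ℕ)}
    (hT : IsAntichain (· ≤ ·) (T : Set (Fin 3 → ℕ))) (σ : Equiv.Perm (Fin 3))
    (P : (Fin 3 → ℕ) → Prop) (hP : ∀ p q, P p → P q → p ≤ q ∨ q ≤ p)
    (hcov : ∀ p ∈ T, p (σ 0) = 0 ∨ P p) {d : ℕ} {x y : Fin 3 → ℕ} (hx : x ∈ T) (hy : y ∈ T)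
    (hxy : x ≠ y) (hxd : ∑ m, x m ≤ d) (hyd : ∑ m, y m ≤ d) : T.card ≤ d + 2 := by
  obtain ⟨q, hq, hq0, hqd⟩ : ∃ q ∈ T, q (σ 0) = 0 ∧ ∑ m, q m ≤ d := by
    rcases hcov x hx with h | h
    · exact ⟨x, hx, h, hxd⟩
    rcases hcov y hy with h' | h'
    · exact ⟨y, hy, h', hyd⟩
    exact absurd ((hP x y h h').elim (hT.eq hx hy) (hT.eq' hx hy)) hxy
  rw [← Equiv.sum_comp σ, Fin.sum_univ_three] at hqd
  have bound : ∀ p ∈ T, p (σ 0) = 0 → q (σ 1) ≤ p (σ 1) → p (σ 2) ≤ q (σ 2) := by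
    intro p hp h0 h1
    by_contra! h2
    have h3 : q = p := hT.eq hq hp ((Pi.le_iff_apply_perm_fin_three σ q p).2 ⟨by omega, h1, h2.le⟩)
    rw [h3] at h2
    exact lt_irrefl _ h2
  refine hT.card_le_of_chain_coloring
    (fun p => if p (σ 0) = 0 then
      if p (σ 1) < q (σ 1) then p (σ 1) else q (σ 1) + p (σ 2) else d + 1) ?_ ?_
  · intro p hp
    have := bound p hp
    split_ifs <;> omega
  · intro p hp r hr h
    have hbp := bound p hp
    have hbr := bound r hr
    by_cases h0 : p (σ 0) = 0 <;> by_cases h1 : r (σ 0) = 0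
    · rw [if_pos h0, if_pos h1] at h
      rw [Pi.le_iff_apply_perm_fin_three σ, Pi.le_iff_apply_perm_fin_three σ]
      split_ifs at h <;> omega
    · rw [if_pos h0, if_neg h1] at h
      split_ifs at h <;> omega
    · rw [if_neg h0, if_pos h1] at h
      split_ifs at h <;> omega
    · exact hP p r ((hcov p hp).resolve_left h0) ((hcov r hr).resolve_left h1)

/-- An antichain in `ℤ_{≥0}^3` containing two points of degree at most `2`, and two more of degree
at most `6`, has at most `10` elements. -/
lemma card_le_ten_of_degree_le {T : Finset (Fin 3 → ℕ)}
    (hT : IsAntichain (· ≤ ·) (T : Set (Fin 3 → ℕ))) {u v x y : Fin 3 → ℕ}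
    (hu : u ∈ T) (hv : v ∈ T) (hx : x ∈ T) (hy : y ∈ T) (huv : u ≠ v) (hxu : x ≠ u) (hxv : x ≠ v)
    (hyu : y ≠ u) (hyv : y ≠ v) (hxy : x ≠ y) (hud : ∑ m, u m ≤ 2) (hvd : ∑ m, v m ≤ 2)
    (hxd : ∑ m, x m ≤ 6) (hyd : ∑ m, y m ≤ 6) : T.card ≤ 10 := by
  suffices h : ((T.erase u).erase v).card ≤ 8 by
    rw [Finset.card_erase_of_mem (Finset.mem_erase.2 ⟨huv.symm, hv⟩),
      Finset.card_erase_of_mem hu] at h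
    omega
  have hT' : IsAntichain (· ≤ ·) (((T.erase u).erase v : Finset _) : Set (Fin 3 → ℕ)) :=
    hT.subset (by exact_mod_cast (Finset.erase_subset _ _).trans (Finset.erase_subset _ _))
  have hx' : x ∈ (T.erase u).erase v := by simp [*]
  have hy' : y ∈ (T.erase u).erase v := by simp [*]
  have hnu : ∀ p ∈ (T.erase u).erase v, ¬ u ≤ p := fun p hp => by
    simp only [Finset.mem_erase] at hp
    exact hT hu hp.2.2 hp.2.1.symm
  have hnv : ∀ p ∈ (T.erase u).erase v, ¬ v ≤ p := fun p hp => by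
    simp only [Finset.mem_erase] at hp
    exact hT hv hp.2.2 hp.1.symm
  generalize (T.erase u).erase v = S at *
  obtain ⟨σ, h⟩ := exists_cover_of_not_ge hud hvd (hT hu hv huv) (hT hv hu huv.symm)
  rcases h with h | h | h | h
  · exact card_le_of_plane_or_chain hT' σ (fun p => p (σ 0) = 1 ∧ p (σ 1) = 0)
      (fun p q hp hq => by
        rw [Pi.le_iff_apply_perm_fin_three σ, Pi.le_iff_apply_perm_fin_three σ]
        omega)
      (fun p hp => h p (hnu p hp) (hnv p hp)) hx' hy' hxy hxd hyd
  · exact card_le_of_plane_or_chain hT' σ (fun p => p (σ 1) = 0 ∧ p (σ 2) = 0)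
      (fun p q hp hq => by
        rw [Pi.le_iff_apply_perm_fin_three σ, Pi.le_iff_apply_perm_fin_three σ]
        omega)
      (fun p hp => h p (hnu p hp) (hnv p hp)) hx' hy' hxy hxd hyd
  · refine hT'.card_le_of_chain_coloring (fun p => 2 * p (σ 0) + p (σ 1)) ?_ ?_
    · intro p hp
      have := h p (hnu p hp) (hnv p hp)
      omega
    · intro p hp q hq hpq
      have := h p (hnu p hp) (hnv p hp)
      have := h q (hnu q hq) (hnv q hq)
      rw [Pi.le_iff_apply_perm_fin_three σ, Pi.le_iff_apply_perm_fin_three σ]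
      omega
  · refine hT'.card_le_of_chain_coloring
      (fun p => 2 * p (σ 0) + if p (σ 1) = 0 then 0 else 1) ?_ ?_
    · intro p hp
      have := h p (hnu p hp) (hnv p hp)
      split_ifs <;> omega
    · intro p hp q hq hpq
      have := h p (hnu p hp) (hnv p hp)
      have := h q (hnu q hq) (hnv q hq)
      rw [Pi.le_iff_apply_perm_fin_three σ, Pi.le_iff_apply_perm_fin_three σ]
      split_ifs at hpq <;> omega

/-- The maximal length of an antichain sequence in `ℤ_{≥0}^3` (componentwise order)
with `deg(s_i) ≤ 2·Fib_i` is equal to `10`. -/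
theorem maximal_antichain_length_dim3_h2 :
    IsGreatest {L : ℕ | ∃ s : Fin L → (Fin 3 → ℕ),
      (∀ i j : Fin L, i ≠ j → ¬ s i ≤ s j) ∧
      (∀ i : Fin L, (∑ k, s i k) ≤ 2 * Nat.fib (i.val + 1))} 10 := by
  constructor
  · refine ⟨![![2, 0, 0], ![1, 1, 0], ![1, 0, 3], ![0, 0, 6], ![0, 1, 5], ![0, 2, 4], ![0, 3, 3],
      ![0, 4, 2], ![0, 5, 1], ![0, 6, 0]], ?_, by decide⟩
    simp only [Pi.le_def]
    decide
  · rintro L ⟨s, hs, hd⟩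
    by_contra! hL
    have hinj : Function.Injective s := fun i j hij => by
      by_contra hne
      exact hs i j hne hij.le
    have hne {i j : Fin L} (hij : i.val ≠ j.val) : s i ≠ s j :=
      hinj.ne fun h => hij (congrArg Fin.val h)
    have hT : IsAntichain (· ≤ ·) ((Finset.univ.image s : Finset _) : Set (Fin 3 → ℕ)) := by
      intro p hp q hq hpq
      simp only [Finset.coe_image, Finset.coe_univ, Set.image_univ, Set.mem_range] at hp hq
      obtain ⟨i, rfl⟩ := hp
      obtain ⟨j, rfl⟩ := hq
      exact hs i j fun h => hpq (congrArg s h)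
    have hmem (i : Fin L) : s i ∈ Finset.univ.image s :=
      Finset.mem_image_of_mem s (Finset.mem_univ i)
    have h := card_le_ten_of_degree_le hT (hmem ⟨0, by omega⟩) (hmem ⟨1, by omega⟩)
      (hmem ⟨2, by omega⟩) (hmem ⟨3, by omega⟩) (hne (by simp)) (hne (by simp)) (hne (by simp))
      (hne (by simp)) (hne (by simp)) (hne (by simp)) (hd _) (hd _)
      ((hd _).trans (show 2 * 2 ≤ 6 by decide)) (hd _)
    rw [Finset.card_image_of_injective _ hinj, Finset.card_univ, Fintype.card_fin] at h
    omega
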